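/- arXiv:2211.12106 — 2 statements merged into one kernel-verified Lean document; each statement's English description precedes it below -/
import Mathlib

section
/- Let κ ∈ C^{1,α}(ℝ) ∩ L^∞(ℝ) for some α > 0 and Γ its harmonic extension to the upper half-plane. Define Γ̃ : ℝ² → ℝ by Γ̃(ξ,δ) = Γ(ξ,δ²) for δ ≠ 0 and Γ̃(ξ,0) = κ(ξ). Then Γ̃ is of class C¹ and, for each fixed ξ, Γ̃(ξ,δ) = κ(ξ) − δ²·(−Δ)^{1/2}κ(ξ) + O(|δ|^{2+2α}) as |δ| → 0. In particular, a point (ξ,0) is a critical point of Γ̃ if and only if ξ is a critical point of κ. -/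
open MeasureTheory Real Asymptotics Filter Topology

theorem integrable_abs_rpow_div_one_add_sq {s : ℝ} (hs : -1 < s) (hs' : s < 1) :
    Integrable fun y : ℝ => |y| ^ s / (1 + y ^ 2) := by
  have hmeas : Measurable fun y : ℝ => |y| ^ s / (1 + y ^ 2) := by fun_prop
  have h01 : IntegrableOn (fun y : ℝ => |y| ^ s / (1 + y ^ 2)) (Set.Ioc 0 1) := by
    have h : IntegrableOn (fun y : ℝ => y ^ s) (Set.Ioc 0 1) :=
      (intervalIntegrable_iff_integrableOn_Ioc_of_le zero_le_one).1
        (intervalIntegral.intervalIntegrable_rpow' hs)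
    refine Integrable.mono' h hmeas.aestronglyMeasurable ?_
    filter_upwards [ae_restrict_mem measurableSet_Ioc] with y hy
    rw [abs_of_pos hy.1, norm_of_nonneg (by have := hy.1; positivity)]
    exact div_le_self (rpow_nonneg hy.1.le _) (by nlinarith [sq_nonneg y])
  have h1 : IntegrableOn (fun y : ℝ => |y| ^ s / (1 + y ^ 2)) (Set.Ioi 1) := by
    refine Integrable.mono' (integrableOn_Ioi_rpow_of_lt (a := s - 2) (by linarith) one_pos)
      hmeas.aestronglyMeasurable ?_
    filter_upwards [ae_restrict_mem measurableSet_Ioi] with y hy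
    have hy0 : 0 < y := one_pos.trans hy
    rw [abs_of_pos hy0, norm_of_nonneg (by positivity), rpow_sub hy0, rpow_two]
    gcongr
    linarith
  have h0 : IntegrableOn (fun y : ℝ => |y| ^ s / (1 + y ^ 2)) (Set.Ioi 0) := by
    rw [← Set.Ioc_union_Ioi_eq_Ioi zero_le_one]
    exact h01.union h1
  have h0' : IntegrableOn (fun y : ℝ => |y| ^ s / (1 + y ^ 2)) (Set.Iic 0) := by
    have h := (integrableOn_Ici_iff_integrableOn_Ioi (by simp)).2 h0
    rw [← neg_zero] at h
    simpa using h.comp_neg_Iic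
  rw [← integrableOn_univ, ← Set.Iic_union_Ioi (a := (0 : ℝ))]
  exact h0'.union h0

theorem integrable_mul_of_continuous_of_bounded {g k : ℝ → ℝ} {M : ℝ} (hg : Continuous g)
    (hM : ∀ x, |g x| ≤ M) (hk : Integrable k) : Integrable fun y => g y * k y :=
  hk.bdd_mul hg.aestronglyMeasurable (ae_of_all _ hM)

theorem abs_sq_sub_one_div_le (y : ℝ) :
    |(y ^ 2 - 1) / (1 + y ^ 2) ^ 2| ≤ (1 + y ^ 2)⁻¹ := by
  have h : (0 : ℝ) < 1 + y ^ 2 := by positivity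
  rw [abs_div, abs_of_pos (pow_pos h 2), div_le_iff₀ (pow_pos h 2)]
  have : (1 + y ^ 2)⁻¹ * (1 + y ^ 2) ^ 2 = 1 + y ^ 2 := by field_simp
  rw [this, abs_le]
  constructor <;> nlinarith [sq_nonneg y]

theorem integrable_sq_sub_one_div :
    Integrable fun y : ℝ => (y ^ 2 - 1) / (1 + y ^ 2) ^ 2 :=
  integrable_inv_one_add_sq.mono' (by fun_prop : Measurable _).aestronglyMeasurable
    (ae_of_all _ abs_sq_sub_one_div_le)

theorem integral_sq_sub_one_div : ∫ y : ℝ, (y ^ 2 - 1) / (1 + y ^ 2) ^ 2 = 0 := by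
  have hlim : Tendsto (fun y : ℝ => -y / (1 + y ^ 2)) (cocompact ℝ) (𝓝 0) := by
    have h : Tendsto (fun y : ℝ => |y|⁻¹) (cocompact ℝ) (𝓝 0) :=
      tendsto_inv_atTop_zero.comp (tendsto_norm_cocompact_atTop (E := ℝ))
    refine squeeze_zero_norm (fun y => ?_) h
    rcases eq_or_ne y 0 with rfl | hy
    · simp
    have hy' : 0 < |y| := abs_pos.2 hy
    rw [norm_div, norm_neg, norm_eq_abs, norm_of_nonneg (by positivity), ← sq_abs,
      div_le_iff₀ (by positivity)]
    field_simp
    linarith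
  have hderiv (y : ℝ) :
      HasDerivAt (fun y : ℝ => -y / (1 + y ^ 2)) ((y ^ 2 - 1) / (1 + y ^ 2) ^ 2) y := by
    have h : (1 + y ^ 2 : ℝ) ≠ 0 := by positivity
    convert! (hasDerivAt_id y).neg.div (((hasDerivAt_id y).pow 2).const_add 1) h using 1
    simp
    ring
  rw [integral_of_hasDerivAt_of_tendsto hderiv integrable_sq_sub_one_div
    (hlim.mono_left atBot_le_cocompact) (hlim.mono_left atTop_le_cocompact), sub_zero]

theorem hasDerivAt_integral_comp_mul_div_one_add_sq {g : ℝ → ℝ} {M μ : ℝ} (hg : Continuous g)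
    (hM : ∀ x, |g x| ≤ M) (hμ : 0 < μ) :
    HasDerivAt (fun μ => ∫ y, g (μ * y) / (1 + y ^ 2))
      (μ⁻¹ * ∫ y, g (μ * y) * ((y ^ 2 - 1) / (1 + y ^ 2) ^ 2)) μ := by
  have hM0 : 0 ≤ M := (abs_nonneg _).trans (hM 0)
  have hint {ν : ℝ} (hν : 0 < ν) : Integrable fun z : ℝ => (ν ^ 2 + z ^ 2)⁻¹ := by
    have h := ((integrable_comp_mul_left_iff _ (inv_ne_zero hν.ne')).2
      integrable_inv_one_add_sq).const_mul (ν ^ 2)⁻¹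
    refine h.congr (ae_of_all _ fun z => ?_)
    simp only
    rw [← mul_inv]
    congr 1
    field_simp
  have hcongr : (fun ν => ∫ z, g z * (ν / (ν ^ 2 + z ^ 2))) =ᶠ[𝓝 μ]
      fun ν => ∫ y, g (ν * y) / (1 + y ^ 2) := by
    filter_upwards [lt_mem_nhds hμ] with ν hν
    have h := Measure.integral_comp_mul_left (fun z => g z * (ν / (ν ^ 2 + z ^ 2))) ν
    rw [abs_of_pos (inv_pos.2 hν), smul_eq_mul, eq_inv_mul_iff_mul_eq₀ hν.ne',
      ← integral_const_mul] at h
    rw [← h]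
    refine integral_congr_ae (ae_of_all _ fun y => ?_)
    simp only
    field_simp
  have hval : μ⁻¹ * ∫ y, g (μ * y) * ((y ^ 2 - 1) / (1 + y ^ 2) ^ 2) =
      ∫ z, g z * ((z ^ 2 - μ ^ 2) / (μ ^ 2 + z ^ 2) ^ 2) := by
    have h := Measure.integral_comp_mul_left
      (fun z => g z * ((z ^ 2 - μ ^ 2) / (μ ^ 2 + z ^ 2) ^ 2)) μ
    rw [abs_of_pos (inv_pos.2 hμ), smul_eq_mul, eq_inv_mul_iff_mul_eq₀ hμ.ne',
      ← integral_const_mul] at h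
    rw [← h, ← integral_const_mul]
    refine integral_congr_ae (ae_of_all _ fun y => ?_)
    simp only
    have : (1 + y ^ 2 : ℝ) ≠ 0 := by positivity
    have : μ ^ 2 + (μ * y) ^ 2 ≠ 0 := by positivity
    field_simp
  rw [hval]
  refine HasDerivAt.congr_of_eventuallyEq ?_ hcongr.symm
  refine (hasDerivAt_integral_of_dominated_loc_of_deriv_le (s := Set.Ioi (μ / 2))
    (F' := fun ν z => g z * ((z ^ 2 - ν ^ 2) / (ν ^ 2 + z ^ 2) ^ 2))
    (bound := fun z => M * ((μ / 2) ^ 2 + z ^ 2)⁻¹)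
    (Ioi_mem_nhds (by linarith)) (Eventually.of_forall fun ν => ?_) ?_ ?_
    (ae_of_all _ fun z ν hν => ?_) ((hint (half_pos hμ)).const_mul M)
    (ae_of_all _ fun z ν hν => ?_)).2
  · exact (by fun_prop : Measurable _).aestronglyMeasurable
  · exact integrable_mul_of_continuous_of_bounded hg hM
      (by simpa [div_eq_mul_inv] using (hint hμ).const_mul μ)
  · exact (by fun_prop : Measurable _).aestronglyMeasurable
  · have hν : μ / 2 < ν := hν
    have hν0 : 0 < ν := (half_pos hμ).trans hν
    rw [norm_mul]
    refine mul_le_mul (hM z) ?_ (norm_nonneg _) hM0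
    have hp : 0 < ν ^ 2 + z ^ 2 := by positivity
    calc ‖(z ^ 2 - ν ^ 2) / (ν ^ 2 + z ^ 2) ^ 2‖
        = |z ^ 2 - ν ^ 2| / (ν ^ 2 + z ^ 2) ^ 2 := by
          rw [norm_div, norm_eq_abs, norm_of_nonneg (by positivity)]
      _ ≤ (ν ^ 2 + z ^ 2) / (ν ^ 2 + z ^ 2) ^ 2 := by
          gcongr
          rw [abs_le]
          constructor <;> nlinarith [sq_nonneg z, sq_nonneg ν]
      _ = (ν ^ 2 + z ^ 2)⁻¹ := by field_simp
      _ ≤ _ := by gcongr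
  · have hν0 : 0 < ν := (half_pos hμ).trans hν
    have hp : ν ^ 2 + z ^ 2 ≠ 0 := by positivity
    refine HasDerivAt.const_mul (g z) ?_
    convert! (hasDerivAt_id ν).div (((hasDerivAt_id ν).pow 2).add_const (z ^ 2)) hp using 1
    simp
    ring

theorem abs_sub_sub_deriv_mul_le {κ : ℝ → ℝ} {α H : ℝ} (hα : 0 ≤ α) (hκ : Differentiable ℝ κ)
    (hH : ∀ x y, |deriv κ x - deriv κ y| ≤ H * |x - y| ^ α) (x h : ℝ) :
    |κ (x + h) - κ x - deriv κ x * h| ≤ H * |h| ^ (1 + α) := by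
  have hH0 : 0 ≤ H := by simpa using (abs_nonneg _).trans (hH 0 1)
  have key := (convex_closedBall x |h|).norm_image_sub_le_of_norm_hasDerivWithin_le
    (f := fun t => κ t - deriv κ x * t) (f' := fun t => deriv κ t - deriv κ x) (C := H * |h| ^ α)
    (x := x) (y := x + h)
    (fun t _ => by
      simpa using! ((hκ t).hasDerivAt.sub
        ((hasDerivAt_id t).const_mul (deriv κ x))).hasDerivWithinAt)
    (fun t ht => (hH t x).trans (by
      have : |t - x| ≤ |h| := by simpa [Real.dist_eq] using ht
      gcongr))
    (by simp) (by simp)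
  rw [rpow_add' (abs_nonneg h) (by linarith), rpow_one]
  convert key using 1
  · rw [norm_eq_abs]
    congr 1
    ring
  · rw [add_sub_cancel_left, norm_eq_abs]
    ring

theorem abs_deriv_le_of_bounded_of_holder {κ : ℝ → ℝ} {α M H : ℝ} (hα : 0 ≤ α)
    (hκ : Differentiable ℝ κ) (hM : ∀ x, |κ x| ≤ M)
    (hH : ∀ x y, |deriv κ x - deriv κ y| ≤ H * |x - y| ^ α) (x : ℝ) :
    |deriv κ x| ≤ 2 * M + H := by
  have h := abs_le.1 (abs_sub_sub_deriv_mul_le hα hκ hH x 1)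
  simp only [abs_one, one_rpow, mul_one] at h
  have h1 := abs_le.1 (hM (x + 1))
  have h2 := abs_le.1 (hM x)
  rw [abs_le]
  constructor <;> linarith

theorem continuous_deriv_of_holder {κ : ℝ → ℝ} {α H : ℝ} (hα : 0 < α)
    (hH : ∀ x y, |deriv κ x - deriv κ y| ≤ H * |x - y| ^ α) : Continuous (deriv κ) := by
  rw [continuous_iff_continuousAt]
  intro x
  rw [ContinuousAt, tendsto_iff_norm_sub_tendsto_zero]
  refine squeeze_zero (fun _ => norm_nonneg _) (fun y => hH y x) ?_
  have h : Continuous fun y => H * |y - x| ^ α :=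
    continuous_const.mul ((continuous_id.sub continuous_const).abs.rpow_const fun _ => Or.inr hα.le)
  simpa [zero_rpow hα.ne'] using h.tendsto x

theorem abs_sub_le_of_abs_deriv_le {κ : ℝ → ℝ} {L : ℝ} (hκ : Differentiable ℝ κ)
    (hL : ∀ x, |deriv κ x| ≤ L) (x y : ℝ) : |κ y - κ x| ≤ L * |y - x| :=
  convex_univ.norm_image_sub_le_of_norm_deriv_le (fun t _ => hκ t) (fun t _ => hL t)
    (Set.mem_univ x) (Set.mem_univ y)

/-- The Poisson extension of `κ` at height `δ ^ 2` above `ξ`. -/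
noncomputable def poissonSq (κ : ℝ → ℝ) (ξ δ : ℝ) : ℝ :=
  (1 / π) * ∫ y : ℝ, κ (ξ + δ ^ 2 * y) / (1 + y ^ 2)

/-- The derivative of `poissonSq κ ξ` at `δ`. -/
noncomputable def poissonSqDeriv (κ : ℝ → ℝ) (ξ δ : ℝ) : ℝ :=
  (2 / π) * ∫ y : ℝ, (κ (ξ + δ ^ 2 * y) - κ ξ) / δ * ((y ^ 2 - 1) / (1 + y ^ 2) ^ 2)

theorem poissonSq_zero (κ : ℝ → ℝ) (ξ : ℝ) : poissonSq κ ξ 0 = κ ξ := by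
  simp [poissonSq, div_eq_mul_inv, integral_const_mul]
  field_simp

theorem continuous_poissonSq {κ : ℝ → ℝ} {M : ℝ} (hκ : Continuous κ) (hM : ∀ x, |κ x| ≤ M) :
    Continuous fun p : ℝ × ℝ => poissonSq κ p.1 p.2 := by
  refine continuous_const.mul (continuous_of_dominated (bound := fun y => M * (1 + y ^ 2)⁻¹)
    (fun p => ?_) (fun p => ae_of_all _ fun y => ?_)
    (integrable_inv_one_add_sq.const_mul M) (ae_of_all _ fun y => by fun_prop))
  · exact (by fun_prop : Measurable _).aestronglyMeasurable
  · rw [norm_div, norm_of_nonneg (by positivity : (0 : ℝ) ≤ 1 + y ^ 2), div_eq_mul_inv]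
    gcongr
    exact hM _

theorem hasDerivAt_poissonSq_left {κ : ℝ → ℝ} {M L : ℝ} (hκ : Differentiable ℝ κ)
    (hM : ∀ x, |κ x| ≤ M) (hL : ∀ x, |deriv κ x| ≤ L) (ξ δ : ℝ) :
    HasDerivAt (fun x => poissonSq κ x δ) (poissonSq (deriv κ) ξ δ) ξ := by
  have hc := hκ.continuous
  refine HasDerivAt.const_mul _ (hasDerivAt_integral_of_dominated_loc_of_deriv_le
    (s := Set.univ) (F' := fun x y => deriv κ (x + δ ^ 2 * y) / (1 + y ^ 2))
    (bound := fun y => L * (1 + y ^ 2)⁻¹) univ_mem (Eventually.of_forall fun x => ?_) ?_ ?_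
    (ae_of_all _ fun y x _ => ?_) (integrable_inv_one_add_sq.const_mul L)
    (ae_of_all _ fun y x _ => ?_)).2
  · exact (by fun_prop : Measurable _).aestronglyMeasurable
  · exact integrable_mul_of_continuous_of_bounded (by fun_prop) (fun _ => hM _)
      integrable_inv_one_add_sq
  · exact (by fun_prop : Measurable _).aestronglyMeasurable
  · rw [norm_div, norm_of_nonneg (by positivity : (0 : ℝ) ≤ 1 + y ^ 2), div_eq_mul_inv]
    gcongr
    exact hL _
  · exact ((hκ _).hasDerivAt.comp_add_const x (δ ^ 2 * y)).div_const _

theorem continuous_poissonSqDeriv {κ : ℝ → ℝ} {M L : ℝ} (hκ : Differentiable ℝ κ)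
    (hM : ∀ x, |κ x| ≤ M) (hL : ∀ x, |deriv κ x| ≤ L) :
    Continuous fun p : ℝ × ℝ => poissonSqDeriv κ p.1 p.2 := by
  have hc := hκ.continuous
  have hM0 : 0 ≤ M := (abs_nonneg _).trans (hM 0)
  have hL0 : 0 ≤ L := (abs_nonneg _).trans (hL 0)
  have hlip (ξ δ y : ℝ) : |(κ (ξ + δ ^ 2 * y) - κ ξ) / δ| ≤ L * |δ| * |y| := by
    rcases eq_or_ne δ 0 with rfl | hδ
    · simp
    have hδ' : 0 < |δ| := abs_pos.2 hδ
    have h := abs_sub_le_of_abs_deriv_le hκ hL ξ (ξ + δ ^ 2 * y)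
    rw [add_sub_cancel_left, abs_mul, abs_pow] at h
    rw [abs_div, div_le_iff₀ hδ']
    linarith
  have hsqrt (ξ δ y : ℝ) :
      |(κ (ξ + δ ^ 2 * y) - κ ξ) / δ| ≤ √(2 * M * L) * |y| ^ (1 / 2 : ℝ) := by
    rw [← sqrt_eq_rpow, ← sqrt_mul (by positivity)]
    refine le_sqrt_of_sq_le ?_
    rcases eq_or_ne δ 0 with rfl | hδ
    · simp
      positivity
    have hδ' : 0 < |δ| := abs_pos.2 hδ
    have h : |(κ (ξ + δ ^ 2 * y) - κ ξ) / δ| ≤ 2 * M / |δ| := by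
      rw [abs_div]
      gcongr
      have h1 := abs_le.1 (hM (ξ + δ ^ 2 * y))
      have h2 := abs_le.1 (hM ξ)
      rw [abs_le]
      constructor <;> linarith
    calc |(κ (ξ + δ ^ 2 * y) - κ ξ) / δ| ^ 2
        = |(κ (ξ + δ ^ 2 * y) - κ ξ) / δ| * |(κ (ξ + δ ^ 2 * y) - κ ξ) / δ| := sq _
      _ ≤ 2 * M / |δ| * (L * |δ| * |y|) :=
          mul_le_mul h (hlip ξ δ y) (abs_nonneg _) (by positivity)
      _ = 2 * M * L * |y| := by field_simp
  refine continuous_const.mul (continuous_of_dominated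
    (bound := fun y => √(2 * M * L) * (|y| ^ (1 / 2 : ℝ) / (1 + y ^ 2)))
    (fun p => ?_) (fun p => ae_of_all _ fun y => ?_)
    ((integrable_abs_rpow_div_one_add_sq (by norm_num) (by norm_num)).const_mul _)
    (ae_of_all _ fun y => Continuous.mul ?_ continuous_const))
  · exact (by fun_prop : Measurable _).aestronglyMeasurable
  · rw [norm_mul, div_eq_mul_inv (|y| ^ (1 / 2 : ℝ)), ← mul_assoc]
    exact mul_le_mul (hsqrt _ _ _) (abs_sq_sub_one_div_le y) (norm_nonneg _) (by positivity)
  · rw [continuous_iff_continuousAt]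
    rintro ⟨ξ, δ⟩
    rcases eq_or_ne δ 0 with rfl | hδ
    · have h : Tendsto (fun p : ℝ × ℝ => L * |p.2| * |y|) (𝓝 (ξ, 0)) (𝓝 0) := by
        have hcont : Continuous fun p : ℝ × ℝ => L * |p.2| * |y| := by fun_prop
        simpa using hcont.tendsto (ξ, 0)
      simpa [ContinuousAt] using squeeze_zero_norm (fun p : ℝ × ℝ => hlip p.1 p.2 y) h
    · exact ContinuousAt.div (by fun_prop) continuousAt_snd hδ

theorem hasDerivAt_poissonSq_right {κ : ℝ → ℝ} {M L : ℝ} (hκ : Differentiable ℝ κ)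
    (hM : ∀ x, |κ x| ≤ M) (hL : ∀ x, |deriv κ x| ≤ L) (ξ δ : ℝ) :
    HasDerivAt (poissonSq κ ξ) (poissonSqDeriv κ ξ δ) δ := by
  have hc := hκ.continuous
  refine hasDerivAt_of_hasDerivAt_of_ne' (f := poissonSq κ ξ) (g := poissonSqDeriv κ ξ) (x := 0)
    (fun d hd => ?_)
    ((continuous_poissonSq hc hM).comp (Continuous.prodMk_right ξ)).continuousAt
    ((continuous_poissonSqDeriv hκ hM hL).comp (Continuous.prodMk_right ξ)).continuousAt δ
  have hg : Continuous fun z => κ (ξ + z) := by fun_prop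
  have hd2 : 0 < d ^ 2 := by positivity
  have h := HasDerivAt.comp (h := fun d : ℝ => d ^ 2) d
    (hasDerivAt_integral_comp_mul_div_one_add_sq hg (fun z => hM (ξ + z)) hd2) (hasDerivAt_pow 2 d)
  have hsplit : ∫ y, (κ (ξ + d ^ 2 * y) - κ ξ) / d * ((y ^ 2 - 1) / (1 + y ^ 2) ^ 2) =
      d⁻¹ * ∫ y, κ (ξ + d ^ 2 * y) * ((y ^ 2 - 1) / (1 + y ^ 2) ^ 2) := by
    have hint : Integrable fun y => κ (ξ + d ^ 2 * y) * ((y ^ 2 - 1) / (1 + y ^ 2) ^ 2) :=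
      integrable_mul_of_continuous_of_bounded (by fun_prop) (fun _ => hM _)
        integrable_sq_sub_one_div
    have hsub := integral_sub hint (integrable_sq_sub_one_div.const_mul (κ ξ))
    rw [integral_const_mul, integral_sq_sub_one_div, mul_zero, sub_zero] at hsub
    rw [← hsub, ← integral_const_mul]
    congr 1 with y
    ring
  convert! h.const_mul (1 / π) using 1
  rw [poissonSqDeriv, hsplit]
  push_cast
  field_simp

theorem hasStrictFDerivAt_poissonSq {κ : ℝ → ℝ} {M L : ℝ} (hκ : Differentiable ℝ κ)
    (hM : ∀ x, |κ x| ≤ M) (hκ' : Continuous (deriv κ)) (hL : ∀ x, |deriv κ x| ≤ L) (p : ℝ × ℝ) :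
    HasStrictFDerivAt (fun p : ℝ × ℝ => poissonSq κ p.1 p.2)
      ((ContinuousLinearMap.toSpanSingleton ℝ (poissonSq (deriv κ) p.1 p.2)).coprod
        (ContinuousLinearMap.toSpanSingleton ℝ (poissonSqDeriv κ p.1 p.2))) p :=
  hasStrictFDerivAt_uncurry_coprod (f := poissonSq κ)
    (f₁ := fun x d => ContinuousLinearMap.toSpanSingleton ℝ (poissonSq (deriv κ) x d))
    (f₂ := fun x d => ContinuousLinearMap.toSpanSingleton ℝ (poissonSqDeriv κ x d))
    (Eventually.of_forall fun q => (hasDerivAt_poissonSq_left hκ hM hL q.1 q.2).hasFDerivAt)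
    (Eventually.of_forall fun q => (hasDerivAt_poissonSq_right hκ hM hL q.1 q.2).hasFDerivAt)
    ((ContinuousLinearMap.toSpanSingletonCLE (𝕜 := ℝ) (E := ℝ)).continuous.comp
      (continuous_poissonSq hκ' hL)).continuousAt
    ((ContinuousLinearMap.toSpanSingletonCLE (𝕜 := ℝ) (E := ℝ)).continuous.comp
      (continuous_poissonSqDeriv hκ hM hL)).continuousAt

theorem contDiff_poissonSq {κ : ℝ → ℝ} {M L : ℝ} (hκ : Differentiable ℝ κ)
    (hM : ∀ x, |κ x| ≤ M) (hκ' : Continuous (deriv κ)) (hL : ∀ x, |deriv κ x| ≤ L) :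
    ContDiff ℝ 1 fun p : ℝ × ℝ => poissonSq κ p.1 p.2 := by
  rw [contDiff_one_iff_hasFDerivAt]
  refine ⟨_, ?_, fun p => (hasStrictFDerivAt_poissonSq hκ hM hκ' hL p).hasFDerivAt⟩
  simp only [← ContinuousLinearMap.comp_fst_add_comp_snd]
  have hspan := (ContinuousLinearMap.toSpanSingletonCLE (𝕜 := ℝ) (E := ℝ)).continuous
  exact ((hspan.comp (continuous_poissonSq hκ' hL)).clm_comp continuous_const).add
    ((hspan.comp (continuous_poissonSqDeriv hκ hM hL)).clm_comp continuous_const)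

theorem abs_poissonSq_sub_le {κ : ℝ → ℝ} {α M H : ℝ} (hα : α ∈ Set.Ioo (0 : ℝ) 1)
    (hκ : Differentiable ℝ κ) (hM : ∀ x, |κ x| ≤ M)
    (hH : ∀ x y, |deriv κ x - deriv κ y| ≤ H * |x - y| ^ α) (ξ δ : ℝ) :
    |poissonSq κ ξ δ -
        (κ ξ - δ ^ 2 * ((1 / (2 * π)) * ∫ y : ℝ, (2 * κ ξ - κ (ξ + y) - κ (ξ - y)) / y ^ 2))| ≤
      H / π * (∫ y : ℝ, |y| ^ (α - 1) / (1 + y ^ 2)) * |δ| ^ (2 + 2 * α) := by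
  have hc := hκ.continuous
  have hα0 := hα.1
  rcases eq_or_ne δ 0 with rfl | hδ
  · rw [poissonSq_zero, abs_zero, zero_rpow (by linarith)]
    simp
  set S : ℝ → ℝ := fun z => 2 * κ ξ - κ (ξ + z) - κ (ξ - z) with hS
  have hSc : Continuous S := by fun_prop
  have hSM (z : ℝ) : |S z| ≤ 4 * M := by
    have h1 := abs_le.1 (hM ξ)
    have h2 := abs_le.1 (hM (ξ + z))
    have h3 := abs_le.1 (hM (ξ - z))
    rw [abs_le]
    constructor <;> linarith
  have hSH (z : ℝ) : |S z| ≤ 2 * H * |z| ^ (1 + α) := by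
    have h1 := abs_le.1 (abs_sub_sub_deriv_mul_le hα0.le hκ hH ξ z)
    have h2 := abs_le.1 (abs_sub_sub_deriv_mul_le hα0.le hκ hH ξ (-z))
    rw [abs_neg, ← sub_eq_add_neg] at h2
    rw [abs_le]
    constructor <;> linarith
  have hμ : 0 < δ ^ 2 := by positivity
  have hpow : (δ ^ 2) ^ (1 + α) = |δ| ^ (2 + 2 * α) := by
    rw [← sq_abs, ← rpow_natCast, ← rpow_mul (abs_nonneg δ)]
    congr 1
    push_cast
    ring
  have hscale : δ ^ 2 * ∫ y, S y / y ^ 2 = ∫ y, S (δ ^ 2 * y) / y ^ 2 := by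
    have h := Measure.integral_comp_mul_left (fun z => S z / z ^ 2) (δ ^ 2)
    rw [abs_of_pos (inv_pos.2 hμ), smul_eq_mul, eq_inv_mul_iff_mul_eq₀ hμ.ne'] at h
    rw [← h, ← mul_assoc, ← integral_const_mul]
    congr 1 with y
    field_simp
  have hbound (y : ℝ) : ‖S (δ ^ 2 * y) / (y ^ 2 * (1 + y ^ 2))‖ ≤
      2 * H * |δ| ^ (2 + 2 * α) * (|y| ^ (α - 1) / (1 + y ^ 2)) := by
    have hH0 : 0 ≤ H := by simpa using (abs_nonneg _).trans (hH 0 1)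
    rcases eq_or_ne y 0 with rfl | hy
    · simp
      positivity
    have hy' : 0 < |y| := abs_pos.2 hy
    have h := hSH (δ ^ 2 * y)
    rw [abs_mul, abs_of_pos hμ, mul_rpow hμ.le hy'.le, hpow] at h
    have hexp : |y| ^ (1 + α) = |y| ^ (α - 1) * y ^ 2 := by
      rw [← sq_abs, ← rpow_natCast, ← rpow_add hy']
      congr 1
      push_cast
      ring
    rw [norm_div, norm_eq_abs, norm_of_nonneg (by positivity), div_le_iff₀ (by positivity)]
    refine h.trans_eq ?_
    rw [hexp]
    field_simp
  have hintbound := (integrable_abs_rpow_div_one_add_sq (s := α - 1) (by linarith)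
    (by linarith [hα.2])).const_mul (2 * H * |δ| ^ (2 + 2 * α))
  have hint : Integrable fun y => S (δ ^ 2 * y) / (y ^ 2 * (1 + y ^ 2)) :=
    hintbound.mono' (by fun_prop : Measurable _).aestronglyMeasurable (ae_of_all _ hbound)
  have hint' : Integrable fun y => S (δ ^ 2 * y) * (1 + y ^ 2)⁻¹ :=
    integrable_mul_of_continuous_of_bounded (by fun_prop) (fun _ => hSM _)
      integrable_inv_one_add_sq
  have hsplit : ∫ y, S (δ ^ 2 * y) / y ^ 2 =
      (∫ y, S (δ ^ 2 * y) / (y ^ 2 * (1 + y ^ 2))) + ∫ y, S (δ ^ 2 * y) * (1 + y ^ 2)⁻¹ := by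
    rw [← integral_add hint hint']
    congr 1 with y
    rcases eq_or_ne y 0 with rfl | hy
    · simp [hS]
      ring
    · field_simp
  have hsymm : ∫ y, S (δ ^ 2 * y) * (1 + y ^ 2)⁻¹ = 2 * π * κ ξ - 2 * π * poissonSq κ ξ δ := by
    have hplus : Integrable fun y => κ (ξ + δ ^ 2 * y) * (1 + y ^ 2)⁻¹ :=
      integrable_mul_of_continuous_of_bounded (by fun_prop) (fun _ => hM _)
        integrable_inv_one_add_sq
    have hminus : Integrable fun y => κ (ξ - δ ^ 2 * y) * (1 + y ^ 2)⁻¹ :=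
      integrable_mul_of_continuous_of_bounded (by fun_prop) (fun _ => hM _)
        integrable_inv_one_add_sq
    have hreflect : ∫ y, κ (ξ - δ ^ 2 * y) * (1 + y ^ 2)⁻¹ =
        ∫ y, κ (ξ + δ ^ 2 * y) * (1 + y ^ 2)⁻¹ := by
      rw [← integral_neg_eq_self]
      simp
    have h := integral_sub ((integrable_inv_one_add_sq.const_mul (2 * κ ξ)).sub hplus) hminus
    simp only [Pi.sub_apply] at h
    rw [integral_sub (integrable_inv_one_add_sq.const_mul (2 * κ ξ)) hplus, hreflect,
      integral_const_mul, integral_univ_inv_one_add_sq] at h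
    simp only [poissonSq, hS, sub_mul, div_eq_mul_inv]
    rw [h]
    field_simp
    ring
  have hmain : poissonSq κ ξ δ - (κ ξ - δ ^ 2 * ((1 / (2 * π)) * ∫ y, S y / y ^ 2)) =
      (1 / (2 * π)) * ∫ y, S (δ ^ 2 * y) / (y ^ 2 * (1 + y ^ 2)) := by
    rw [mul_left_comm, hscale, hsplit, hsymm]
    field_simp
    ring
  rw [hmain, abs_mul, abs_of_pos (by positivity)]
  have h := norm_integral_le_of_norm_le hintbound (ae_of_all _ hbound)
  rw [integral_const_mul, norm_eq_abs] at h
  calc _ ≤ 1 / (2 * π) * (2 * H * |δ| ^ (2 + 2 * α) * ∫ y : ℝ, |y| ^ (α - 1) / (1 + y ^ 2)) := by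
        gcongr
    _ = _ := by field_simp

theorem extended_Gamma_C1_and_expansion (κ : ℝ → ℝ) (α M H : ℝ) (hα : α ∈ Set.Ioo (0 : ℝ) 1)
    (hκ : Differentiable ℝ κ)
    (hM : ∀ x, |κ x| ≤ M)
    (hH : ∀ x y, |deriv κ x - deriv κ y| ≤ H * |x - y| ^ α)
    (Γtil : ℝ × ℝ → ℝ)
    (hΓtil : Γtil = fun p : ℝ × ℝ =>
      if p.2 = 0 then κ p.1 else (1 / π) * ∫ y : ℝ, κ (p.1 + p.2 ^ 2 * y) / (1 + y ^ 2)) :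
    ContDiff ℝ 1 Γtil ∧
    (∀ ξ : ℝ,
      (fun δ : ℝ => Γtil (ξ, δ) -
          (κ ξ - δ ^ 2 * ((1 / (2 * π)) * ∫ y : ℝ, (2 * κ ξ - κ (ξ + y) - κ (ξ - y)) / y ^ 2)))
        =O[𝓝 (0 : ℝ)] fun δ => |δ| ^ (2 + 2 * α)) ∧
    (∀ ξ : ℝ, fderiv ℝ Γtil (ξ, 0) = 0 ↔ deriv κ ξ = 0) := by
  have hκ' := continuous_deriv_of_holder hα.1 hH
  have hL := abs_deriv_le_of_bounded_of_holder hα.1.le hκ hM hH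
  have hΓ : Γtil = fun p : ℝ × ℝ => poissonSq κ p.1 p.2 := by
    rw [hΓtil]
    funext p
    split_ifs with hp
    · rw [hp, poissonSq_zero]
    · rfl
  subst hΓ
  refine ⟨contDiff_poissonSq hκ hM hκ' hL, fun ξ => ?_, fun ξ => ?_⟩
  · refine IsBigO.of_bound (H / π * ∫ y : ℝ, |y| ^ (α - 1) / (1 + y ^ 2))
      (Eventually.of_forall fun δ => ?_)
    rw [norm_of_nonneg (rpow_nonneg (abs_nonneg δ) _)]
    exact abs_poissonSq_sub_le hα hκ hM hH ξ δ
  · rw [(hasStrictFDerivAt_poissonSq hκ hM hκ' hL (ξ, 0)).hasFDerivAt.fderiv]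
    have h0 : poissonSqDeriv κ ξ 0 = 0 := by simp [poissonSqDeriv]
    simp only [poissonSq_zero, h0]
    constructor
    · intro h
      simpa using congrArg (fun f : ℝ × ℝ →L[ℝ] ℝ => f (1, 0)) h
    · intro h
      ext <;> simp [h]
end

section
/- Suppose κ ∈ C²_{*,β}(ℝ) satisfies: (i) there exists R₀ > 0 such that xκ'(x) < 0 for all |x| > R₀, and (ii) ∫_ℝ κ'(x)·x dx < 0. Then there exists R₁ > 0 such that for all (ξ,μ) in the upper half-plane with |ξ| + μ ≥ R₁, one has ∇Γ(ξ,μ)·(ξ,μ) < 0, where Γ is the Poisson extension of κ. -/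
open MeasureTheory Real

/-- The scaled and the convolution form of the Poisson integral agree, up to the factor `π⁻¹`. -/
lemma poisson_integral_comp_affine (g : ℝ → ℝ) (ξ : ℝ) {μ : ℝ} (hμ : 0 < μ) :
    ∫ y : ℝ, g (ξ + μ * y) / (1 + y ^ 2) = μ * ∫ x : ℝ, g x / (μ ^ 2 + (x - ξ) ^ 2) := by
  have key := Measure.integral_comp_mul_left
    (fun z : ℝ => μ ^ 2 * (g (ξ + z) / (μ ^ 2 + z ^ 2))) μ
  have shift := integral_add_left_eq_self (μ := volume)
    (fun x : ℝ => g x / (μ ^ 2 + (x - ξ) ^ 2)) ξ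
  simp only [add_sub_cancel_left] at shift
  have hscale : ∀ y : ℝ, μ ^ 2 * (g (ξ + μ * y) / (μ ^ 2 + (μ * y) ^ 2))
      = g (ξ + μ * y) / (1 + y ^ 2) := by
    intro y
    have h1 : (1 + y ^ 2) ≠ 0 := by positivity
    have h2 : μ ^ 2 + (μ * y) ^ 2 = μ ^ 2 * (1 + y ^ 2) := by ring
    rw [h2]
    field_simp
  simp only [hscale] at key
  rw [key, integral_const_mul, shift, abs_of_pos (inv_pos.2 hμ), smul_eq_mul]
  field_simp

lemma integrable_const_div_one_add_sq (B : ℝ) : Integrable fun y : ℝ => B / (1 + y ^ 2) := by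
  simpa [div_eq_mul_inv] using integrable_inv_one_add_sq.const_mul B

/-- Differentiation under the integral sign for the scaled Poisson extension. -/
lemma hasFDerivAt_poisson_scaled {κ : ℝ → ℝ} {C : ℝ} (hκ : ContDiff ℝ 1 κ)
    (h0 : ∀ x, |κ x| ≤ C) (h1 : ∀ x, |deriv κ x| ≤ C) (h2 : ∀ x, |x| * |deriv κ x| ≤ C)
    (ξ : ℝ) {μ : ℝ} (hμ : 0 < μ) :
    ∃ L : ℝ × ℝ →L[ℝ] ℝ,
      HasFDerivAt (fun p : ℝ × ℝ => ∫ y : ℝ, κ (p.1 + p.2 * y) / (1 + y ^ 2)) L (ξ, μ) ∧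
      L (ξ, μ) = ∫ y : ℝ, deriv κ (ξ + μ * y) * (ξ + μ * y) / (1 + y ^ 2) := by
  have hC : 0 ≤ C := (abs_nonneg _).trans (h0 0)
  have hκc : Continuous κ := hκ.continuous
  have hκ' : Continuous (deriv κ) := hκ.continuous_deriv le_rfl
  have hpos : ∀ y : ℝ, 0 < 1 + y ^ 2 := fun y => by positivity
  let F : ℝ × ℝ → ℝ → ℝ := fun p y => κ (p.1 + p.2 * y) / (1 + y ^ 2)
  let F' : ℝ × ℝ → ℝ → (ℝ × ℝ →L[ℝ] ℝ) := fun p y =>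
    (deriv κ (p.1 + p.2 * y) / (1 + y ^ 2)) •
      (ContinuousLinearMap.fst ℝ ℝ ℝ + y • ContinuousLinearMap.snd ℝ ℝ ℝ)
  let B : ℝ := C + 2 * C * (1 + |ξ| + μ) / μ
  have hFc : ∀ p, Continuous (F p) := fun p =>
    (hκc.comp (by fun_prop)).div (by fun_prop) fun y => (hpos y).ne'
  have hF'c : Continuous (F' (ξ, μ)) :=
    ((hκ'.comp (by fun_prop)).div (by fun_prop) fun y => (hpos y).ne').smul (by fun_prop)
  have hFint : Integrable (F (ξ, μ)) := by
    refine (integrable_const_div_one_add_sq C).mono' (hFc _).aestronglyMeasurable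
      (Filter.Eventually.of_forall fun y => ?_)
    rw [norm_eq_abs, abs_div, abs_of_pos (hpos y)]
    exact div_le_div_of_nonneg_right (h0 _) (hpos y).le
  have hbound : ∀ y : ℝ, ∀ p ∈ Metric.ball (ξ, μ) (μ / 2), ‖F' p y‖ ≤ B / (1 + y ^ 2) := by
    intro y p hp
    have hp' : dist p.1 ξ < μ / 2 ∧ dist p.2 μ < μ / 2 := by
      simpa [Prod.dist_eq] using hp
    rw [dist_eq, dist_eq] at hp'
    have hp1 : |p.1| ≤ |ξ| + μ := by
      have := abs_sub_abs_le_abs_sub p.1 ξ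
      linarith [hp'.1]
    have hp2 : μ / 2 ≤ p.2 := by linarith [(abs_lt.1 hp'.2).1]
    have hlin : ‖ContinuousLinearMap.fst ℝ ℝ ℝ + y • ContinuousLinearMap.snd ℝ ℝ ℝ‖
        ≤ 1 + |y| := by
      refine (norm_add_le _ _).trans (add_le_add (ContinuousLinearMap.norm_fst_le ..) ?_)
      rw [norm_smul, norm_eq_abs]
      exact mul_le_of_le_one_right (abs_nonneg y) (ContinuousLinearMap.norm_snd_le ..)
    set d := |deriv κ (p.1 + p.2 * y)| with hd
    have hd0 : 0 ≤ d := abs_nonneg _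
    have hdC : d ≤ C := h1 _
    have hy : |y| * d ≤ 2 * C * (1 + |ξ| + μ) / μ := by
      rw [le_div_iff₀ hμ]
      have habs : p.2 * |y| ≤ |p.1 + p.2 * y| + |p.1| := by
        have := abs_sub (p.1 + p.2 * y) p.1
        rw [add_sub_cancel_left, abs_mul, abs_of_pos (by linarith : 0 < p.2)] at this
        exact this
      have hle : μ / 2 * |y| ≤ |p.1 + p.2 * y| + (|ξ| + μ) :=
        (mul_le_mul_of_nonneg_right hp2 (abs_nonneg y)).trans (habs.trans (by linarith))
      have hmul := mul_le_mul_of_nonneg_right hle hd0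
      have hx : |p.1 + p.2 * y| * d ≤ C := h2 _
      have hc : (|ξ| + μ) * d ≤ (|ξ| + μ) * C :=
        mul_le_mul_of_nonneg_left hdC (by positivity)
      nlinarith
    have hnorm : ‖F' p y‖ ≤ d / (1 + y ^ 2) * (1 + |y|) := by
      rw [norm_smul, norm_eq_abs, abs_div, abs_of_pos (hpos y)]
      exact mul_le_mul_of_nonneg_left hlin (div_nonneg hd0 (hpos y).le)
    refine hnorm.trans ?_
    rw [div_mul_eq_mul_div]
    refine div_le_div_of_nonneg_right ?_ (hpos y).le
    change _ ≤ C + _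
    linarith
  have hdiff : ∀ y : ℝ, ∀ p ∈ Metric.ball (ξ, μ) (μ / 2),
      HasFDerivAt (fun q => F q y) (F' p y) p := by
    intro y p _
    have hin : HasFDerivAt (fun q : ℝ × ℝ => q.1 + q.2 * y)
        (ContinuousLinearMap.fst ℝ ℝ ℝ + y • ContinuousLinearMap.snd ℝ ℝ ℝ) p :=
      hasFDerivAt_fst.add (hasFDerivAt_snd.mul_const y)
    have hout : HasDerivAt κ (deriv κ (p.1 + p.2 * y)) (p.1 + p.2 * y) :=
      ((hκ.differentiable one_ne_zero) _).hasDerivAt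
    exact (hout.div_const (1 + y ^ 2)).comp_hasFDerivAt p hin
  have hder := hasFDerivAt_integral_of_dominated_of_fderiv_le (μ := volume)
    (Metric.ball_mem_nhds (ξ, μ) (half_pos hμ))
    (Filter.Eventually.of_forall fun p => (hFc p).aestronglyMeasurable) hFint
    hF'c.aestronglyMeasurable (Filter.Eventually.of_forall hbound)
    (integrable_const_div_one_add_sq B) (Filter.Eventually.of_forall hdiff)
  refine ⟨_, hder, ?_⟩
  have hF'int : Integrable (F' (ξ, μ)) :=
    (integrable_const_div_one_add_sq B).mono' hF'c.aestronglyMeasurable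
      (Filter.Eventually.of_forall fun y =>
        hbound y _ (Metric.mem_ball_self (half_pos hμ)))
  rw [ContinuousLinearMap.integral_apply hF'int]
  refine integral_congr_ae (Filter.Eventually.of_forall fun y => ?_)
  simp only [F', smul_apply, add_apply,
    ContinuousLinearMap.coe_fst', ContinuousLinearMap.coe_snd', smul_eq_mul]
  ring

/-- Far from the origin the Poisson kernel is nearly constant on a bounded interval. -/
lemma abs_poisson_kernel_ratio_sub_one_le {A ε ξ μ x : ℝ} (hε : 0 < ε) (hε1 : ε ≤ 1)
    (hμ : 0 < μ) (hx : |x| ≤ A) (hS : 16 * A / ε ≤ |ξ| + μ) :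
    |(μ ^ 2 + ξ ^ 2) / (μ ^ 2 + (x - ξ) ^ 2) - 1| ≤ ε := by
  have hD : 0 < μ ^ 2 + (x - ξ) ^ 2 := by positivity
  have hA : 0 ≤ A := (abs_nonneg x).trans hx
  set S := |ξ| + μ with hSdef
  have hξS : |ξ| ≤ S := by linarith
  have hS0 : 0 < S := by positivity
  have hAS : 16 * A ≤ ε * S := by
    rw [div_le_iff₀ hε] at hS
    linarith
  have hρ : S ^ 2 / 2 ≤ μ ^ 2 + ξ ^ 2 := by
    rw [hSdef, ← sq_abs ξ]
    nlinarith [sq_nonneg (|ξ| - μ)]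
  have hx2 : x ^ 2 ≤ A ^ 2 := by
    rw [← sq_abs x]
    exact pow_le_pow_left₀ (abs_nonneg x) hx 2
  have hxξ : |x * ξ| ≤ A * S := by
    rw [abs_mul]
    exact mul_le_mul hx hξS (abs_nonneg ξ) hA
  obtain ⟨hl, hu⟩ := abs_le.1 hxξ
  have hAS2 : 16 * (A * S) ≤ ε * S ^ 2 := by nlinarith
  have hA16 : 16 * A ≤ S := hAS.trans (mul_le_of_le_one_left hS0.le hε1)
  have hA2 : 16 * A ^ 2 ≤ A * S := by nlinarith
  have hAS0 : 0 ≤ A * S := by positivity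
  have hlow : S ^ 2 / 4 ≤ μ ^ 2 + (x - ξ) ^ 2 := by nlinarith [sq_nonneg x, sq_nonneg S]
  have hεlow := mul_le_mul_of_nonneg_left hlow hε.le
  rw [div_sub_one hD.ne', abs_div, abs_of_pos hD, div_le_iff₀ hD, abs_le]
  constructor <;> nlinarith [sq_nonneg x]

/-- A function of positive integral that is nonnegative near infinity has positive Poisson
integral at all points of the upper half-plane far from the origin. -/
lemma exists_poisson_integral_pos {f : ℝ → ℝ} (hf : Integrable f) (hpos : 0 < ∫ x, f x)
    {R₀ : ℝ} (hsign : ∀ x, R₀ < |x| → 0 ≤ f x) :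
    ∃ R₁ : ℝ, 0 < R₁ ∧ ∀ ξ μ : ℝ, 0 < μ → R₁ ≤ |ξ| + μ →
      0 < ∫ x : ℝ, f x / (μ ^ 2 + (x - ξ) ^ 2) := by
  set m := ∫ x, f x with hm
  set I := ∫ x, |f x| with hI
  have hI0 : 0 ≤ I := integral_nonneg fun x => abs_nonneg _
  obtain ⟨A, hA0, hAR, hAm⟩ : ∃ A : ℝ, 0 < A ∧ R₀ ≤ A ∧ m / 2 < ∫ x in Set.Ioc (-A) A, f x := by
    have ht := intervalIntegral_tendsto_integral hf Filter.tendsto_neg_atTop_atBot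
      Filter.tendsto_id
    have hev := ht.eventually (lt_mem_nhds (half_lt_self hpos))
    obtain ⟨A, h1, h2, h3⟩ := (hev.and
      ((Filter.eventually_gt_atTop 0).and (Filter.eventually_ge_atTop R₀))).exists
    refine ⟨A, h2, h3, ?_⟩
    rwa [intervalIntegral.integral_of_le (by simp only [id]; linarith)] at h1
  set ε := min 1 (m / (4 * (I + 1))) with hεdef
  have hε : 0 < ε := lt_min one_pos (by positivity)
  have hεI : ε * I < m / 2 := by
    have h1 : ε * (4 * (I + 1)) ≤ m := by
      rw [← le_div_iff₀ (by positivity)]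
      exact min_le_right _ _
    nlinarith
  refine ⟨16 * A / ε, by positivity, fun ξ μ hμ hS => ?_⟩
  have hD : ∀ x : ℝ, 0 < μ ^ 2 + (x - ξ) ^ 2 := fun x => by positivity
  have hρ : 0 < μ ^ 2 + ξ ^ 2 := by positivity
  let g : ℝ → ℝ := fun x => f x * ((μ ^ 2 + ξ ^ 2) / (μ ^ 2 + (x - ξ) ^ 2))
  have hg : Integrable g := by
    refine hf.mul_bdd (c := (μ ^ 2 + ξ ^ 2) / μ ^ 2) ?_ (Filter.Eventually.of_forall fun x => ?_)
    · exact (continuous_const.div (by fun_prop) fun x => (hD x).ne').aestronglyMeasurable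
    · rw [norm_eq_abs, abs_of_pos (div_pos hρ (hD x))]
      exact div_le_div_of_nonneg_left hρ.le (by positivity) (by nlinarith [sq_nonneg (x - ξ)])
  have hgf : ∫ x, g x = (μ ^ 2 + ξ ^ 2) * ∫ x : ℝ, f x / (μ ^ 2 + (x - ξ) ^ 2) := by
    rw [← integral_const_mul]
    refine integral_congr_ae (Filter.Eventually.of_forall fun x => ?_)
    simp only [g]
    ring
  suffices 0 < ∫ x, g x by
    rw [hgf] at this
    exact pos_of_mul_pos_right this hρ.le
  rw [← integral_add_compl (measurableSet_Ioc (a := -A) (b := A)) hg]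
  have hout : 0 ≤ ∫ x in (Set.Ioc (-A) A)ᶜ, g x := by
    have hae : ∀ᵐ x ∂volume.restrict (Set.Ioc (-A) A)ᶜ, 0 ≤ g x := by
      have hne : ∀ᵐ x : ℝ ∂volume.restrict (Set.Ioc (-A) A)ᶜ, x ≠ -A :=
        ae_restrict_of_ae (Measure.ae_ne volume (-A))
      filter_upwards [hne, ae_restrict_mem measurableSet_Ioc.compl] with x hx hxmem
      refine mul_nonneg (hsign x (hAR.trans_lt ?_)) (div_pos hρ (hD x)).le
      rw [lt_abs]
      by_contra! hcon
      exact hxmem ⟨lt_of_le_of_ne (by linarith) hx.symm, hcon.1⟩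
    exact integral_nonneg_of_ae hae
  have hin : (∫ x in Set.Ioc (-A) A, f x) - ε * I ≤ ∫ x in Set.Ioc (-A) A, g x := by
    have hle : ∫ x in Set.Ioc (-A) A, (f x - ε * |f x|) ≤ ∫ x in Set.Ioc (-A) A, g x := by
      refine setIntegral_mono_on (hf.sub (hf.abs.const_mul ε)).integrableOn hg.integrableOn
        measurableSet_Ioc fun x hx => ?_
      have hk := abs_poisson_kernel_ratio_sub_one_le hε (min_le_left _ _) hμ
        (abs_le.2 ⟨hx.1.le, hx.2⟩) hS
      have hmul := mul_le_mul_of_nonneg_left hk (abs_nonneg (f x))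
      rw [← abs_mul] at hmul
      have := (abs_le.1 hmul).1
      simp only [g]
      linarith
    rw [integral_sub hf.integrableOn (hf.abs.const_mul ε).integrableOn, integral_const_mul] at hle
    have hIle : ∫ x in Set.Ioc (-A) A, |f x| ≤ I :=
      setIntegral_le_integral hf.abs (Filter.Eventually.of_forall fun x => abs_nonneg _)
    have := mul_le_mul_of_nonneg_left hIle hε.le
    linarith
  linarith

theorem no_critical_points_at_infinity (κ : ℝ → ℝ) (β : ℝ) (hβ : β ∈ Set.Ioo (0 : ℝ) 1)
    (hκ : ContDiff ℝ 2 κ) (C : ℝ)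
    (hbd : ∀ x, |κ x| + (1 + |x| ^ (2 + β)) * |deriv κ x| + |deriv (deriv κ) x| ≤ C)
    (R₀ : ℝ) (hR₀ : 0 < R₀)
    (hsign : ∀ x : ℝ, R₀ < |x| → x * deriv κ x < 0)
    (hint : ∫ x : ℝ, deriv κ x * x < 0)
    (Γ : ℝ × ℝ → ℝ)
    (hΓ : Γ = fun p : ℝ × ℝ => (p.2 / π) * ∫ x : ℝ, κ x / (p.2 ^ 2 + (x - p.1) ^ 2)) :
    ∃ R₁ : ℝ, 0 < R₁ ∧ ∀ ξ μ : ℝ, 0 < μ → R₁ ≤ |ξ| + μ →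
      fderiv ℝ Γ (ξ, μ) (ξ, μ) < 0 := by
  have hpow : ∀ x : ℝ, 0 ≤ |x| ^ (2 + β) := fun x => rpow_nonneg (abs_nonneg x) _
  have hw : ∀ x, (1 + |x| ^ (2 + β)) * |deriv κ x| ≤ C := fun x => by
    linarith [hbd x, abs_nonneg (κ x), abs_nonneg (deriv (deriv κ) x)]
  have h0 : ∀ x, |κ x| ≤ C := fun x => by
    have := mul_nonneg (add_nonneg zero_le_one (hpow x)) (abs_nonneg (deriv κ x))
    linarith [hbd x, abs_nonneg (deriv (deriv κ) x)]
  have h1 : ∀ x, |deriv κ x| ≤ C := fun x =>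
    (le_mul_of_one_le_left (abs_nonneg _) (by linarith [hpow x])).trans (hw x)
  have h2 : ∀ x, |x| * |deriv κ x| ≤ C := fun x => by
    refine (mul_le_mul_of_nonneg_right ?_ (abs_nonneg _)).trans (hw x)
    rcases le_total |x| 1 with hx | hx
    · linarith [hpow x]
    · have := rpow_le_rpow_of_exponent_le hx (by linarith [hβ.1] : (1 : ℝ) ≤ 2 + β)
      rw [rpow_one] at this
      linarith
  have hf : Integrable fun x : ℝ => deriv κ x * x := by
    by_contra h
    rw [integral_undef h] at hint
    exact lt_irrefl _ hint
  obtain ⟨R₁, hR₁, hR⟩ := exists_poisson_integral_pos (f := fun x => -(deriv κ x * x)) hf.neg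
    (by rw [integral_neg]; linarith) (R₀ := R₀)
    (fun x hx => by nlinarith [hsign x hx])
  refine ⟨R₁, hR₁, fun ξ μ hμ hS => ?_⟩
  obtain ⟨L, hL, hLv⟩ := hasFDerivAt_poisson_scaled (hκ.of_le one_le_two) h0 h1 h2 ξ hμ
  have hΓL : HasFDerivAt Γ (π⁻¹ • L) (ξ, μ) := by
    refine (hL.const_smul π⁻¹).congr_of_eventuallyEq ?_
    have hopen : ∀ᶠ p : ℝ × ℝ in nhds (ξ, μ), 0 < p.2 :=
      continuous_snd.continuousAt.eventually (lt_mem_nhds hμ)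
    filter_upwards [hopen] with p hp
    simp only [hΓ, Pi.smul_apply, smul_eq_mul]
    rw [poisson_integral_comp_affine κ p.1 hp]
    ring
  have hval : ∫ y : ℝ, deriv κ (ξ + μ * y) * (ξ + μ * y) / (1 + y ^ 2) < 0 := by
    rw [poisson_integral_comp_affine (fun x => deriv κ x * x) ξ hμ]
    have := hR ξ μ hμ hS
    simp only [neg_div, integral_neg] at this
    exact mul_neg_of_pos_of_neg hμ (by linarith)
  rw [hΓL.fderiv, smul_apply, hLv, smul_eq_mul]
  exact mul_neg_of_pos_of_neg (inv_pos.2 pi_pos) hval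
end
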